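/- (Closed form of Hermite variational orthogonal features.) Let v, ℓ > 0 and r > 0 with 2r² > ℓ², let s(ω) = v ℓ exp(-ℓ²ω²/2), and let ψ̃_m^{(r)}(ω) = H_m(rω) e^{-r²ω²/2} · 2^{-m/2}√r / (π^{1/4}√(m!)). Then for all real x: (2π)^{-1/4} F⁻¹[ψ̃_m^{(r)}/√s](x) = i^m · (2π)^{-1/4} · (2^{-m/2}√r)/(π^{1/4}√(vℓ)·√(m!)) · (r² - ℓ²/2)^{-1/2} · exp( -x² / (2(r² - ℓ²/2)) ) · ((r² + ℓ²/2)/(r² - ℓ²/2))^{m/2} · H_m( r x / √((r² - ℓ²/2)(r² + ℓ²/2)) ). -/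

import Mathlib

open MeasureTheory Real

/-- The physicists' Hermite polynomials: `H_0(x)=1`, `H_1(x)=2x`,
`H_{m+1}(x) = 2x H_m(x) - 2m H_{m-1}(x)`. -/
noncomputable def hermiteH : ℕ → ℝ → ℝ
  | 0, _ => 1
  | 1, x => 2 * x
  | n + 2, x => 2 * x * hermiteH (n + 1) x - 2 * (n + 1) * hermiteH n x

theorem hasDerivAt_hermiteH (m : ℕ) (x : ℝ) :
    HasDerivAt (hermiteH m) (2 * m * hermiteH (m - 1) x) x := by
  induction m using Nat.twoStepInduction with
  | zero =>
    have h : hermiteH 0 = fun _ => (1 : ℝ) := by ext; simp [hermiteH]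
    rw [h]
    simpa using hasDerivAt_const x (1 : ℝ)
  | one =>
    have h : hermiteH 1 = fun y => 2 * y := by ext; simp [hermiteH]
    rw [h]
    simpa [hermiteH] using (hasDerivAt_id x).const_mul 2
  | more n ih₀ ih₁ =>
    have h : hermiteH (n + 2) =
        fun y => 2 * y * hermiteH (n + 1) y - 2 * (n + 1) * hermiteH n y := by
      ext; simp [hermiteH]
    rw [h]
    have hd := (((hasDerivAt_id x).const_mul 2).mul ih₁).sub (ih₀.const_mul (2 * ((n : ℝ) + 1)))
    refine hd.congr_deriv ?_
    cases n with
    | zero => simp [hermiteH]; ring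
    | succ k => simp [hermiteH]; ring

theorem integrable_pow_mul_cexp_quadratic {a : ℝ} (ha : 0 < a) (x : ℝ) (k : ℕ) :
    Integrable fun ω : ℝ =>
      ((ω ^ k : ℝ) : ℂ) * Complex.exp (-(a / 2) * ω ^ 2 + Complex.I * x * ω) := by
  have h := integrable_rpow_mul_exp_neg_mul_sq (half_pos ha)
    (show (-1 : ℝ) < k by linarith [k.cast_nonneg (α := ℝ)])
  refine h.mono (by fun_prop) (Filter.Eventually.of_forall fun ω => le_of_eq ?_)
  rw [norm_mul, norm_mul, Complex.norm_exp, Real.rpow_natCast, Complex.norm_real,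
    Real.norm_of_nonneg (Real.exp_pos _).le]
  congr 2
  simp [pow_two]

theorem integrable_pow_mul_hermiteH_mul_cexp {a : ℝ} (ha : 0 < a) (r x : ℝ) (m k : ℕ) :
    Integrable fun ω : ℝ => ((ω ^ k * hermiteH m (r * ω) : ℝ) : ℂ) *
      Complex.exp (-(a / 2) * ω ^ 2 + Complex.I * x * ω) := by
  induction m using Nat.twoStepInduction generalizing k with
  | zero => simpa [hermiteH] using integrable_pow_mul_cexp_quadratic ha x k
  | one =>
    refine ((integrable_pow_mul_cexp_quadratic ha x (k + 1)).const_mul (2 * r : ℂ)).congr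
      (Filter.Eventually.of_forall fun ω => ?_)
    simp only [hermiteH]
    push_cast
    ring
  | more n ih₀ ih₁ =>
    refine (((ih₁ (k + 1)).const_mul (2 * r : ℂ)).sub
      ((ih₀ k).const_mul (2 * ((n : ℂ) + 1)))).congr (Filter.Eventually.of_forall fun ω => ?_)
    simp only [hermiteH, Pi.sub_apply]
    push_cast
    ring

/-- Integration by parts for a Hermite polynomial against a modulated Gaussian. -/
theorem integral_mul_hermiteH_mul_cexp {a : ℝ} (ha : 0 < a) (r x : ℝ) (m : ℕ) :
    a * ∫ ω : ℝ, ((ω * hermiteH m (r * ω) : ℝ) : ℂ) *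
        Complex.exp (-(a / 2) * ω ^ 2 + Complex.I * x * ω) =
      2 * m * r * (∫ ω : ℝ, (hermiteH (m - 1) (r * ω) : ℂ) *
        Complex.exp (-(a / 2) * ω ^ 2 + Complex.I * x * ω)) +
      Complex.I * x * ∫ ω : ℝ, (hermiteH m (r * ω) : ℂ) *
        Complex.exp (-(a / 2) * ω ^ 2 + Complex.I * x * ω) := by
  set g : ℝ → ℂ := fun ω => Complex.exp (-(a / 2) * ω ^ 2 + Complex.I * x * ω) with hg
  have h₁ : Integrable fun ω : ℝ => ((ω * hermiteH m (r * ω) : ℝ) : ℂ) * g ω := by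
    simpa only [pow_one] using integrable_pow_mul_hermiteH_mul_cexp ha r x m 1
  have h₀ (n : ℕ) : Integrable fun ω : ℝ => (hermiteH n (r * ω) : ℂ) * g ω := by
    simpa only [pow_zero, one_mul] using integrable_pow_mul_hermiteH_mul_cexp ha r x n 0
  have hderiv (ω : ℝ) : HasDerivAt (fun ω : ℝ => (hermiteH m (r * ω) : ℂ) * g ω)
      (2 * m * r * ((hermiteH (m - 1) (r * ω) : ℂ) * g ω) +
        Complex.I * x * ((hermiteH m (r * ω) : ℂ) * g ω) -
        a * (((ω * hermiteH m (r * ω) : ℝ) : ℂ) * g ω)) ω := by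
    have hH := ((hasDerivAt_hermiteH m (r * ω)).comp ω
      ((hasDerivAt_id ω).const_mul r)).ofReal_comp
    have hω : HasDerivAt (fun ω : ℝ => (ω : ℂ)) 1 ω := (hasDerivAt_id ω).ofReal_comp
    have hG := (((hω.pow 2).const_mul (-(a / 2) : ℂ)).add
      (hω.const_mul (Complex.I * x))).cexp
    refine (hH.mul hG).congr_deriv ?_
    simp [hg]
    ring
  have hsum : Integrable fun ω : ℝ => 2 * m * r * ((hermiteH (m - 1) (r * ω) : ℂ) * g ω) +
      Complex.I * x * ((hermiteH m (r * ω) : ℂ) * g ω) :=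
    ((h₀ (m - 1)).const_mul _).add ((h₀ m).const_mul _)
  have h := integral_eq_zero_of_hasDerivAt_of_integrable hderiv
    (hsum.sub (h₁.const_mul _)) (h₀ m)
  rw [integral_sub hsum (h₁.const_mul _),
    integral_add ((h₀ (m - 1)).const_mul _) ((h₀ m).const_mul _), integral_const_mul,
    integral_const_mul, integral_const_mul] at h
  exact (sub_eq_zero.mp h).symm

theorem integral_hermiteH_add_two_mul_cexp {a : ℝ} (ha : 0 < a) (r x : ℝ) (m : ℕ) :
    ∫ ω : ℝ, (hermiteH (m + 2) (r * ω) : ℂ) *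
        Complex.exp (-(a / 2) * ω ^ 2 + Complex.I * x * ω) =
      2 * Complex.I * r * x / a * (∫ ω : ℝ, (hermiteH (m + 1) (r * ω) : ℂ) *
        Complex.exp (-(a / 2) * ω ^ 2 + Complex.I * x * ω)) +
      2 * (m + 1) * ((2 * r ^ 2 - a) / a) * ∫ ω : ℝ, (hermiteH m (r * ω) : ℂ) *
        Complex.exp (-(a / 2) * ω ^ 2 + Complex.I * x * ω) := by
  have h := integral_mul_hermiteH_mul_cexp ha r x (m + 1)
  have h₁ := integrable_pow_mul_hermiteH_mul_cexp ha r x (m + 1) 1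
  have h₀ := integrable_pow_mul_hermiteH_mul_cexp ha r x m 0
  simp only [pow_one, pow_zero, one_mul] at h₁ h₀
  have hrec : ∫ ω : ℝ, (hermiteH (m + 2) (r * ω) : ℂ) *
        Complex.exp (-(a / 2) * ω ^ 2 + Complex.I * x * ω) =
      2 * r * (∫ ω : ℝ, ((ω * hermiteH (m + 1) (r * ω) : ℝ) : ℂ) *
        Complex.exp (-(a / 2) * ω ^ 2 + Complex.I * x * ω)) -
      2 * (m + 1) * ∫ ω : ℝ, (hermiteH m (r * ω) : ℂ) *
        Complex.exp (-(a / 2) * ω ^ 2 + Complex.I * x * ω) := by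
    rw [← integral_const_mul, ← integral_const_mul,
      ← integral_sub (h₁.const_mul _) (h₀.const_mul _)]
    refine integral_congr_ae (Filter.Eventually.of_forall fun ω => ?_)
    simp only [hermiteH]
    push_cast
    ring
  have ha' : (a : ℂ) ≠ 0 := by exact_mod_cast ha.ne'
  rw [hrec]
  simp only [Nat.add_sub_cancel, Nat.cast_add, Nat.cast_one] at h
  generalize (∫ ω : ℝ, ((ω * hermiteH (m + 1) (r * ω) : ℝ) : ℂ) *
    Complex.exp (-(a / 2) * ω ^ 2 + Complex.I * x * ω)) = K at *
  generalize (∫ ω : ℝ, (hermiteH (m + 1) (r * ω) : ℂ) *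
    Complex.exp (-(a / 2) * ω ^ 2 + Complex.I * x * ω)) = J at *
  generalize (∫ ω : ℝ, (hermiteH m (r * ω) : ℂ) *
    Complex.exp (-(a / 2) * ω ^ 2 + Complex.I * x * ω)) = I at *
  field_simp
  linear_combination (r : ℂ) * h

/-- The Fourier integral of a dilated Hermite polynomial times a Gaussian. -/
theorem integral_hermiteH_mul_cexp {a r : ℝ} (ha : 0 < a) (hc : 0 < 2 * r ^ 2 - a)
    (x : ℝ) (m : ℕ) :
    ∫ ω : ℝ, (hermiteH m (r * ω) : ℂ) *
        Complex.exp (-(a / 2) * ω ^ 2 + Complex.I * x * ω) =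
      Complex.I ^ m * (√((2 * r ^ 2 - a) / a) : ℂ) ^ m *
        hermiteH m (r * x / √(a * (2 * r ^ 2 - a))) *
        ∫ ω : ℝ, Complex.exp (-(a / 2) * ω ^ 2 + Complex.I * x * ω) := by
  have hq : (√((2 * r ^ 2 - a) / a) : ℂ) ^ 2 = (2 * r ^ 2 - a) / a := by
    exact_mod_cast Real.sq_sqrt (div_pos hc ha).le
  have hqy : (√((2 * r ^ 2 - a) / a) : ℂ) * ((r * x / √(a * (2 * r ^ 2 - a)) : ℝ) : ℂ) =
      r * x / a := by
    norm_cast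
    rw [Real.sqrt_div hc.le, Real.sqrt_mul ha.le]
    have h₁ := (Real.sqrt_pos.2 hc).ne'
    have h₂ := (Real.sqrt_pos.2 ha).ne'
    have h₃ := Real.sq_sqrt ha.le
    field_simp
    rw [h₃]
  induction m using Nat.twoStepInduction with
  | zero => simp [hermiteH]
  | one =>
    have h := integral_mul_hermiteH_mul_cexp ha r x 0
    have ha' : (a : ℂ) ≠ 0 := by exact_mod_cast ha.ne'
    simp only [hermiteH, mul_one, Nat.cast_zero, mul_zero, zero_mul, zero_add,
      Complex.ofReal_one, one_mul] at h
    have hlin : ∫ ω : ℝ, (hermiteH 1 (r * ω) : ℂ) *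
          Complex.exp (-(a / 2) * ω ^ 2 + Complex.I * x * ω) =
        2 * r * ∫ ω : ℝ, (ω : ℂ) *
          Complex.exp (-(a / 2) * ω ^ 2 + Complex.I * x * ω) := by
      rw [← integral_const_mul]
      refine integral_congr_ae (Filter.Eventually.of_forall fun ω => ?_)
      simp only [hermiteH]
      push_cast
      ring
    rw [hlin, eq_div_of_mul_eq ha' ((mul_comm _ _).trans h)]
    simp only [hermiteH, pow_one]
    rw [Complex.ofReal_mul, Complex.ofReal_ofNat]
    linear_combination (-2 * Complex.I *
      ∫ ω : ℝ, Complex.exp (-(a / 2) * ω ^ 2 + Complex.I * x * ω)) * hqy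
  | more n ih₀ ih₁ =>
    rw [integral_hermiteH_add_two_mul_cexp ha, ih₀, ih₁]
    simp only [hermiteH]
    generalize r * x / √(a * (2 * r ^ 2 - a)) = y at *
    generalize (√((2 * r ^ 2 - a) / a) : ℂ) = q at *
    rw [← hq, show 2 * Complex.I * r * x / a = 2 * Complex.I * (q * y) by rw [hqy]; ring]
    push_cast
    linear_combination (2 * (n + 1) * Complex.I ^ n * q ^ (n + 2) * (hermiteH n y : ℂ) *
      ∫ ω : ℝ, Complex.exp (-(a / 2) * ω ^ 2 + Complex.I * x * ω)) * Complex.I_sq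

theorem integral_cexp_neg_half_mul_sq_add_I_mul {a : ℝ} (ha : 0 < a) (x : ℝ) :
    ∫ ω : ℝ, Complex.exp (-(a / 2) * ω ^ 2 + Complex.I * x * ω) =
      (((2 * π) ^ ((1 : ℝ) / 2) * a ^ (-(1 : ℝ) / 2) * Real.exp (-x ^ 2 / (2 * a)) : ℝ) : ℂ) := by
  have h := integral_cexp_quadratic (b := -(a / 2 : ℂ)) (by simpa using ha) (Complex.I * x) 0
  simp only [add_zero] at h
  have ha' : (a : ℂ) ≠ 0 := by exact_mod_cast ha.ne'
  have hbase : (π : ℂ) / - -(a / 2 : ℂ) = ((2 * π / a : ℝ) : ℂ) := by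
    push_cast
    field_simp
  have hexp : (0 : ℂ) - (Complex.I * x) ^ 2 / (4 * -(a / 2 : ℂ)) =
      ((-x ^ 2 / (2 * a) : ℝ) : ℂ) := by
    push_cast
    rw [mul_pow, Complex.I_sq]
    field_simp
    ring
  rw [h, hbase, hexp, ← Complex.ofReal_exp, Complex.ofReal_mul,
    show (1 / 2 : ℂ) = ((1 / 2 : ℝ) : ℂ) by push_cast; rfl,
    ← Complex.ofReal_cpow (by positivity), Real.div_rpow (by positivity) ha.le,
    show -(1 : ℝ) / 2 = -(1 / 2) by ring, Real.rpow_neg ha.le, div_eq_mul_inv]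

/-- **Closed form of Hermite variational orthogonal features.**
For `v, ℓ, r > 0` with `2r² > ℓ²`, with `s(ω) = vℓ e^{-ℓ²ω²/2}` and
`ψ̃_m(ω) = H_m(rω) e^{-r²ω²/2} 2^{-m/2}√r/(π^{1/4}√(m!))`, for all real `x`:
`(2π)^{-1/4} F⁻¹[ψ̃_m/√s](x) = i^m (2π)^{-1/4} (2^{-m/2}√r)/(π^{1/4}√(vℓ)√(m!))
  (r²-ℓ²/2)^{-1/2} exp(-x²/(2(r²-ℓ²/2))) ((r²+ℓ²/2)/(r²-ℓ²/2))^{m/2}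
  H_m(rx/√((r²-ℓ²/2)(r²+ℓ²/2)))`. -/
theorem statement_7 (v ℓ r : ℝ) (hv : 0 < v) (hℓ : 0 < ℓ) (hr : 0 < r)
    (h2r : ℓ ^ 2 < 2 * r ^ 2) (m : ℕ) (x : ℝ) :
    (((2 * π) ^ (-(1 : ℝ) / 4) : ℝ) : ℂ) *
      ((((2 * π) ^ (-(1 : ℝ) / 2) : ℝ) : ℂ) *
        ∫ ω : ℝ,
          ((hermiteH m (r * ω) * Real.exp (-(r ^ 2 * ω ^ 2) / 2) *
              ((2 : ℝ) ^ (-(m : ℝ) / 2) * Real.sqrt r /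
                (π ^ ((1 : ℝ) / 4) * Real.sqrt (Nat.factorial m))) /
              Real.sqrt (v * ℓ * Real.exp (-(ℓ ^ 2 * ω ^ 2) / 2)) : ℝ) : ℂ) *
            Complex.exp (Complex.I * (ω : ℂ) * (x : ℂ))) =
    Complex.I ^ m * (((2 * π) ^ (-(1 : ℝ) / 4) : ℝ) : ℂ) *
      (((2 : ℝ) ^ (-(m : ℝ) / 2) * Real.sqrt r /
          (π ^ ((1 : ℝ) / 4) * Real.sqrt (v * ℓ) * Real.sqrt (Nat.factorial m)) : ℝ) : ℂ) *
      ((((r ^ 2 - ℓ ^ 2 / 2) ^ (-(1 : ℝ) / 2) : ℝ)) : ℂ) *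
      ((Real.exp (-x ^ 2 / (2 * (r ^ 2 - ℓ ^ 2 / 2))) : ℝ) : ℂ) *
      (((((r ^ 2 + ℓ ^ 2 / 2) / (r ^ 2 - ℓ ^ 2 / 2)) ^ ((m : ℝ) / 2) : ℝ)) : ℂ) *
      ((hermiteH m (r * x / Real.sqrt ((r ^ 2 - ℓ ^ 2 / 2) * (r ^ 2 + ℓ ^ 2 / 2))) : ℝ) : ℂ) := by
  have ha : 0 < r ^ 2 - ℓ ^ 2 / 2 := by linarith
  have hc : 0 < r ^ 2 + ℓ ^ 2 / 2 := by positivity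
  have hca : 2 * r ^ 2 - (r ^ 2 - ℓ ^ 2 / 2) = r ^ 2 + ℓ ^ 2 / 2 := by ring
  set C : ℝ := (2 : ℝ) ^ (-(m : ℝ) / 2) * √r / (π ^ ((1 : ℝ) / 4) * √(v * ℓ) * √(m.factorial))
    with hC
  have hint (ω : ℝ) :
      ((hermiteH m (r * ω) * Real.exp (-(r ^ 2 * ω ^ 2) / 2) *
          ((2 : ℝ) ^ (-(m : ℝ) / 2) * √r / (π ^ ((1 : ℝ) / 4) * √(m.factorial))) /
          √(v * ℓ * Real.exp (-(ℓ ^ 2 * ω ^ 2) / 2)) : ℝ) : ℂ) *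
        Complex.exp (Complex.I * (ω : ℂ) * (x : ℂ)) =
      C * ((hermiteH m (r * ω) : ℂ) *
        Complex.exp (-((r ^ 2 - ℓ ^ 2 / 2 : ℝ) / 2) * ω ^ 2 + Complex.I * x * ω)) := by
    have hreal : hermiteH m (r * ω) * Real.exp (-(r ^ 2 * ω ^ 2) / 2) *
          ((2 : ℝ) ^ (-(m : ℝ) / 2) * √r / (π ^ ((1 : ℝ) / 4) * √(m.factorial))) /
          √(v * ℓ * Real.exp (-(ℓ ^ 2 * ω ^ 2) / 2)) =
        C * (hermiteH m (r * ω) * Real.exp (-((r ^ 2 - ℓ ^ 2 / 2) / 2) * ω ^ 2)) := by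
      rw [Real.sqrt_mul (by positivity), ← Real.exp_half,
        show -((r ^ 2 - ℓ ^ 2 / 2) / 2) * ω ^ 2 =
          -(r ^ 2 * ω ^ 2) / 2 - -(ℓ ^ 2 * ω ^ 2) / 2 / 2 by ring, Real.exp_sub, hC]
      simp only [div_eq_mul_inv, mul_inv]
      ring
    rw [hreal, Complex.exp_add]
    push_cast
    ring_nf
  have hpow : ((r ^ 2 + ℓ ^ 2 / 2) / (r ^ 2 - ℓ ^ 2 / 2)) ^ ((m : ℝ) / 2) =
      √((r ^ 2 + ℓ ^ 2 / 2) / (r ^ 2 - ℓ ^ 2 / 2)) ^ m := by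
    rw [Real.sqrt_eq_rpow, ← Real.rpow_mul_natCast (by positivity)]
    ring_nf
  have hpi : (((2 * π) ^ (-(1 : ℝ) / 2) : ℝ) : ℂ) * (((2 * π) ^ ((1 : ℝ) / 2) : ℝ) : ℂ) = 1 := by
    rw [← Complex.ofReal_mul, ← Real.rpow_add (by positivity)]
    norm_num
  simp only [hint]
  rw [integral_const_mul, integral_hermiteH_mul_cexp ha (hca ▸ hc), hca,
    integral_cexp_neg_half_mul_sq_add_I_mul ha, hpow, Complex.ofReal_mul, Complex.ofReal_mul,
    Complex.ofReal_pow]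
  linear_combination ((((2 * π) ^ (-(1 : ℝ) / 4) : ℝ) : ℂ) * C * Complex.I ^ m *
    (√((r ^ 2 + ℓ ^ 2 / 2) / (r ^ 2 - ℓ ^ 2 / 2)) : ℂ) ^ m *
    (hermiteH m (r * x / √((r ^ 2 - ℓ ^ 2 / 2) * (r ^ 2 + ℓ ^ 2 / 2))) : ℂ) *
    (((r ^ 2 - ℓ ^ 2 / 2) ^ (-(1 : ℝ) / 2) : ℝ) : ℂ) *
    ((Real.exp (-x ^ 2 / (2 * (r ^ 2 - ℓ ^ 2 / 2))) : ℝ) : ℂ)) * hpi
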